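/- (Theorem 4.8, curvature form) If η = ⟨U_x, x − c⟩ vanishes identically on the patch x, then the Gauss curvatures of x and of its inverse patch satisfy K̃ = λ⁻²K at every point (u,v), where K = (eg − f²)/(EG − F²) and K̃ = (ẽg̃ − f̃²)/(ẼG̃ − F̃²); consequently K̃ and K have the same sign and |K̃| = λ⁻²|K|. -/

import Mathlib

noncomputable section
open scoped RealInnerProductSpace

/-- ℝ³ as Euclidean 3-space. -/
abbrev E3 : Type := EuclideanSpace ℝ (Fin 3)

/-- The cross product on ℝ³. -/
def cross (a b : E3) : E3 :=
  (WithLp.equiv 2 (Fin 3 → ℝ)).symm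
    ![a 1 * b 2 - a 2 * b 1, a 2 * b 0 - a 0 * b 2, a 0 * b 1 - a 1 * b 0]

/-- The inversion of ℝ³ with center `c` and radius `r`. -/
def inv3 (c : E3) (r : ℝ) (p : E3) : E3 :=
  c + (r ^ 2 / ‖p - c‖ ^ 2) • (p - c)

/-- Partial derivative in the first variable. -/
def pu {E : Type*} [NormedAddCommGroup E] [NormedSpace ℝ E]
    (x : ℝ → ℝ → E) (u v : ℝ) : E :=
  deriv (fun t => x t v) u

/-- Partial derivative in the second variable. -/
def pv {E : Type*} [NormedAddCommGroup E] [NormedSpace ℝ E]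
    (x : ℝ → ℝ → E) (u v : ℝ) : E :=
  deriv (fun t => x u t) v

/-- The unit normal of a patch. -/
def unormal (x : ℝ → ℝ → E3) (u v : ℝ) : E3 :=
  ‖cross (pu x u v) (pv x u v)‖⁻¹ • cross (pu x u v) (pv x u v)

/-- The conformal factor λ of the inversion along the patch. -/
def lam (c : E3) (r : ℝ) (x : ℝ → ℝ → E3) (u v : ℝ) : ℝ :=
  r ^ 2 / ‖x u v - c‖ ^ 2

/-- The support-type function η = ⟨U_x, x − c⟩. -/
def eta (c : E3) (x : ℝ → ℝ → E3) (u v : ℝ) : ℝ :=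
  ⟪unormal x u v, x u v - c⟫

/-- First fundamental form coefficient E. -/
def FFE (x : ℝ → ℝ → E3) (u v : ℝ) : ℝ := ⟪pu x u v, pu x u v⟫
/-- First fundamental form coefficient F. -/
def FFF (x : ℝ → ℝ → E3) (u v : ℝ) : ℝ := ⟪pu x u v, pv x u v⟫
/-- First fundamental form coefficient G. -/
def FFG (x : ℝ → ℝ → E3) (u v : ℝ) : ℝ := ⟪pv x u v, pv x u v⟫
/-- Second fundamental form coefficient e. -/
def SFe (x : ℝ → ℝ → E3) (u v : ℝ) : ℝ := ⟪pu (pu x) u v, unormal x u v⟫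
/-- Second fundamental form coefficient f. -/
def SFf (x : ℝ → ℝ → E3) (u v : ℝ) : ℝ := ⟪pv (pu x) u v, unormal x u v⟫
/-- Second fundamental form coefficient g. -/
def SFg (x : ℝ → ℝ → E3) (u v : ℝ) : ℝ := ⟪pv (pv x) u v, unormal x u v⟫
/-- Third fundamental form coefficient P. -/
def TFP (x : ℝ → ℝ → E3) (u v : ℝ) : ℝ := ⟪pu (unormal x) u v, pu (unormal x) u v⟫
/-- Third fundamental form coefficient Q. -/
def TFQ (x : ℝ → ℝ → E3) (u v : ℝ) : ℝ := ⟪pu (unormal x) u v, pv (unormal x) u v⟫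
/-- Third fundamental form coefficient R. -/
def TFR (x : ℝ → ℝ → E3) (u v : ℝ) : ℝ := ⟪pv (unormal x) u v, pv (unormal x) u v⟫

/-- Christoffel symbol Γ¹₁₁. -/
def Ch111 (x : ℝ → ℝ → E3) (u v : ℝ) : ℝ :=
  (FFG x u v * pu (FFE x) u v - 2 * FFF x u v * pu (FFF x) u v + FFF x u v * pv (FFE x) u v) /
    (2 * (FFE x u v * FFG x u v - FFF x u v ^ 2))
/-- Christoffel symbol Γ²₁₁. -/
def Ch211 (x : ℝ → ℝ → E3) (u v : ℝ) : ℝ :=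
  (2 * FFE x u v * pu (FFF x) u v - FFE x u v * pv (FFE x) u v - FFF x u v * pu (FFE x) u v) /
    (2 * (FFE x u v * FFG x u v - FFF x u v ^ 2))
/-- Christoffel symbol Γ¹₁₂. -/
def Ch112 (x : ℝ → ℝ → E3) (u v : ℝ) : ℝ :=
  (FFG x u v * pv (FFE x) u v - FFF x u v * pu (FFG x) u v) /
    (2 * (FFE x u v * FFG x u v - FFF x u v ^ 2))
/-- Christoffel symbol Γ²₁₂. -/
def Ch212 (x : ℝ → ℝ → E3) (u v : ℝ) : ℝ :=
  (FFE x u v * pu (FFG x) u v - FFF x u v * pv (FFE x) u v) /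
    (2 * (FFE x u v * FFG x u v - FFF x u v ^ 2))
/-- Christoffel symbol Γ¹₂₂. -/
def Ch122 (x : ℝ → ℝ → E3) (u v : ℝ) : ℝ :=
  (2 * FFG x u v * pv (FFF x) u v - FFG x u v * pu (FFG x) u v - FFF x u v * pv (FFG x) u v) /
    (2 * (FFE x u v * FFG x u v - FFF x u v ^ 2))
/-- Christoffel symbol Γ²₂₂. -/
def Ch222 (x : ℝ → ℝ → E3) (u v : ℝ) : ℝ :=
  (FFE x u v * pv (FFG x) u v - 2 * FFF x u v * pv (FFF x) u v + FFF x u v * pu (FFG x) u v) /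
    (2 * (FFE x u v * FFG x u v - FFF x u v ^ 2))

/-- The tangent map of the inversion at `p`. -/
def phiStar (c : E3) (r : ℝ) (p : E3) (w : E3) : E3 :=
  (r ^ 2 / ‖p - c‖ ^ 2) • w - (2 * r ^ 2 * ⟪p - c, w⟫ / ‖p - c‖ ^ 4) • (p - c)

/-! ### Partial derivatives of smooth two-parameter families -/

section PartialDerivatives

variable {E : Type*} [NormedAddCommGroup E] [NormedSpace ℝ E]

/-- Smoothness of a two-parameter family, jointly in both parameters. -/
def SmoothPatch (f : ℝ → ℝ → E) : Prop :=
  ContDiff ℝ (⊤ : ℕ∞) (fun p : ℝ × ℝ => f p.1 p.2)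

lemma SmoothPatch.differentiableAt_left {f : ℝ → ℝ → E} (hf : SmoothPatch f) (u v : ℝ) :
    DifferentiableAt ℝ (fun t => f t v) u :=
  (ContDiff.comp (g := fun p : ℝ × ℝ => f p.1 p.2) (f := fun t : ℝ => (t, v)) hf
    (contDiff_id.prodMk contDiff_const)).differentiable (by simp) u

lemma SmoothPatch.differentiableAt_right {f : ℝ → ℝ → E} (hf : SmoothPatch f) (u v : ℝ) :
    DifferentiableAt ℝ (fun t => f u t) v :=
  (ContDiff.comp (g := fun p : ℝ × ℝ => f p.1 p.2) (f := fun t : ℝ => (u, t)) hf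
    (contDiff_const.prodMk contDiff_id)).differentiable (by simp) v

lemma SmoothPatch.pu {f : ℝ → ℝ → E} (hf : SmoothPatch f) : SmoothPatch (pu f) := by
  have key : (fun p : ℝ × ℝ => _root_.pu f p.1 p.2) =
      fun p => fderiv ℝ (fun p : ℝ × ℝ => f p.1 p.2) p (1, 0) := by
    funext p
    have h := (ContDiff.differentiable hf (by simp) p).hasFDerivAt
    exact (h.comp_hasDerivAt (f := fun t : ℝ => (t, p.2)) p.1
      ((hasDerivAt_id p.1).prodMk (hasDerivAt_const p.1 p.2))).deriv
  unfold SmoothPatch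
  rw [key]
  exact (ContDiff.fderiv_right hf (by simp)).clm_apply contDiff_const

lemma SmoothPatch.pv {f : ℝ → ℝ → E} (hf : SmoothPatch f) : SmoothPatch (pv f) := by
  have key : (fun p : ℝ × ℝ => _root_.pv f p.1 p.2) =
      fun p => fderiv ℝ (fun p : ℝ × ℝ => f p.1 p.2) p (0, 1) := by
    funext p
    have h := (ContDiff.differentiable hf (by simp) p).hasFDerivAt
    exact (h.comp_hasDerivAt (f := fun t : ℝ => (p.1, t)) p.2
      ((hasDerivAt_const p.2 p.1).prodMk (hasDerivAt_id p.2))).deriv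
  unfold SmoothPatch
  rw [key]
  exact (ContDiff.fderiv_right hf (by simp)).clm_apply contDiff_const

lemma pu_smul_add_smul {a b : ℝ → ℝ → ℝ} {f g : ℝ → ℝ → E} (ha : SmoothPatch a)
    (hb : SmoothPatch b) (hf : SmoothPatch f) (hg : SmoothPatch g) (u v : ℝ) :
    pu (fun u v => a u v • f u v + b u v • g u v) u v =
      (a u v • pu f u v + pu a u v • f u v) + (b u v • pu g u v + pu b u v • g u v) :=
  (((ha.differentiableAt_left u v).hasDerivAt.smul
      (hf.differentiableAt_left u v).hasDerivAt).add
    ((hb.differentiableAt_left u v).hasDerivAt.smul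
      (hg.differentiableAt_left u v).hasDerivAt)).deriv

lemma pv_smul_add_smul {a b : ℝ → ℝ → ℝ} {f g : ℝ → ℝ → E} (ha : SmoothPatch a)
    (hb : SmoothPatch b) (hf : SmoothPatch f) (hg : SmoothPatch g) (u v : ℝ) :
    pv (fun u v => a u v • f u v + b u v • g u v) u v =
      (a u v • pv f u v + pv a u v • f u v) + (b u v • pv g u v + pv b u v • g u v) :=
  (((ha.differentiableAt_right u v).hasDerivAt.smul
      (hf.differentiableAt_right u v).hasDerivAt).add
    ((hb.differentiableAt_right u v).hasDerivAt.smul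
      (hg.differentiableAt_right u v).hasDerivAt)).deriv

lemma pu_add_smul_sub {a : ℝ → ℝ → ℝ} {f : ℝ → ℝ → E} (ha : SmoothPatch a)
    (hf : SmoothPatch f) (c d : E) :
    pu (fun u v => c + a u v • (f u v - d)) =
      fun u v => a u v • pu f u v + pu a u v • (f u v - d) := by
  funext u v
  exact (((ha.differentiableAt_left u v).hasDerivAt.smul
    ((hf.differentiableAt_left u v).hasDerivAt.sub_const d)).const_add c).deriv

lemma pv_add_smul_sub {a : ℝ → ℝ → ℝ} {f : ℝ → ℝ → E} (ha : SmoothPatch a)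
    (hf : SmoothPatch f) (c d : E) :
    pv (fun u v => c + a u v • (f u v - d)) =
      fun u v => a u v • pv f u v + pv a u v • (f u v - d) := by
  funext u v
  exact (((ha.differentiableAt_right u v).hasDerivAt.smul
    ((hf.differentiableAt_right u v).hasDerivAt.sub_const d)).const_add c).deriv

lemma pu_sub_const (f : ℝ → ℝ → E) (d : E) : pu (fun u v => f u v - d) = pu f := by
  funext u v
  exact deriv_sub_const d

lemma pv_sub_const (f : ℝ → ℝ → E) (d : E) : pv (fun u v => f u v - d) = pv f := by
  funext u v
  exact deriv_sub_const d

end PartialDerivatives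

/-! ### The conformal factor -/

lemma smoothPatch_lam {c : E3} {r : ℝ} {x : ℝ → ℝ → E3} (hx : SmoothPatch x)
    (hxc : ∀ u v, x u v ≠ c) : SmoothPatch (lam c r x) :=
  contDiff_const.div ((ContDiff.sub hx contDiff_const).norm_sq ℝ) fun p =>
    pow_ne_zero 2 (norm_ne_zero_iff.2 (sub_ne_zero.2 (hxc p.1 p.2)))

/-- The logarithmic derivative of `r ^ 2 / ‖γ - c‖ ^ 2` along a curve `γ` avoiding `c`. -/
lemma deriv_mul_inner_of_eq_div_norm_sq {c : E3} {r : ℝ} {γ : ℝ → E3} {t : ℝ}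
    (hγ : DifferentiableAt ℝ γ t) (hc : γ t ≠ c) :
    deriv (fun s => r ^ 2 / ‖γ s - c‖ ^ 2) t * ⟪γ t - c, γ t - c⟫ =
      -2 * (r ^ 2 / ‖γ t - c‖ ^ 2) * ⟪γ t - c, deriv γ t⟫ := by
  have hq : ‖γ t - c‖ ≠ 0 := norm_ne_zero_iff.2 (sub_ne_zero.2 hc)
  have h := ((hasDerivAt_const t (r ^ 2)).div (hγ.hasDerivAt.sub_const c).norm_sq
    (pow_ne_zero 2 hq)).deriv
  have h' : deriv (fun s => r ^ 2 / ‖γ s - c‖ ^ 2) t = _ := h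
  rw [h', real_inner_self_eq_norm_sq]
  field_simp
  ring

/-! ### Algebra of the tangent map of the inversion -/

section Algebra

variable {a b w : E3} {l α β : ℝ}

lemma inner_smul_add_smul (hw : w ≠ 0) (hα : α * ⟪w, w⟫ = -2 * l * ⟪w, a⟫)
    (hβ : β * ⟪w, w⟫ = -2 * l * ⟪w, b⟫) :
    ⟪l • a + α • w, l • b + β • w⟫ = l ^ 2 * ⟪a, b⟫ := by
  have hq : ⟪w, w⟫ ≠ 0 := inner_self_ne_zero.2 hw
  simp only [inner_add_left, inner_add_right, real_inner_smul_left, real_inner_smul_right,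
    real_inner_comm w a]
  apply mul_right_cancel₀ hq
  linear_combination (l * ⟪w, b⟫ + β * ⟪w, w⟫) * hα - l * ⟪w, a⟫ * hβ

lemma cross_smul_add_smul (hw : w ≠ 0) (hN : ⟪cross a b, w⟫ = 0)
    (hα : α * ⟪w, w⟫ = -2 * l * ⟪w, a⟫) (hβ : β * ⟪w, w⟫ = -2 * l * ⟪w, b⟫) :
    cross (l • a + α • w) (l • b + β • w) = -(l ^ 2 • cross a b) := by
  have hq : ⟪w, w⟫ ≠ 0 := inner_self_ne_zero.2 hw
  ext i
  apply mul_right_cancel₀ hq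
  simp only [PiLp.inner_apply, Fin.sum_univ_three, cross, RCLike.inner_apply, conj_trivial,
    WithLp.equiv_symm_apply, Matrix.cons_val_zero, Matrix.cons_val_one, Matrix.cons_val]
    at hN hα hβ ⊢
  fin_cases i <;> simp
  · linear_combination l * (w 1 * b 2 - w 2 * b 1) * hα + l * (a 1 * w 2 - a 2 * w 1) * hβ
      + 2 * l ^ 2 * w 0 * hN
  · linear_combination l * (w 2 * b 0 - w 0 * b 2) * hα + l * (a 2 * w 0 - a 0 * w 2) * hβ
      + 2 * l ^ 2 * w 1 * hN
  · linear_combination l * (w 0 * b 1 - w 1 * b 0) * hα + l * (a 0 * w 1 - a 1 * w 0) * hβ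
      + 2 * l ^ 2 * w 2 * hN

lemma inner_cross_left (a b : E3) : ⟪a, cross a b⟫ = 0 := by
  simp [PiLp.inner_apply, Fin.sum_univ_three, cross]
  ring

lemma inner_cross_right (a b : E3) : ⟪b, cross a b⟫ = 0 := by
  simp [PiLp.inner_apply, Fin.sum_univ_three, cross]
  ring

end Algebra

lemma inner_pu_unormal (x : ℝ → ℝ → E3) (u v : ℝ) : ⟪pu x u v, unormal x u v⟫ = 0 := by
  rw [unormal, real_inner_smul_right, inner_cross_left, mul_zero]

lemma inner_pv_unormal (x : ℝ → ℝ → E3) (u v : ℝ) : ⟪pv x u v, unormal x u v⟫ = 0 := by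
  rw [unormal, real_inner_smul_right, inner_cross_right, mul_zero]

lemma sign_mul_of_pos {a : ℝ} (ha : 0 < a) (b : ℝ) : Real.sign (a * b) = Real.sign b := by
  rcases lt_trichotomy b 0 with hb | rfl | hb
  · rw [Real.sign_of_neg hb, Real.sign_of_neg (mul_neg_of_pos_of_neg ha hb)]
  · rw [mul_zero]
  · rw [Real.sign_of_pos hb, Real.sign_of_pos (mul_pos ha hb)]

theorem inverse_patch_gauss_curvature_eta_zero
    (c : E3) (r : ℝ) (hr : 0 < r)
    (x : ℝ → ℝ → E3)
    (hx : ContDiff ℝ (⊤ : ℕ∞) (fun p : ℝ × ℝ => x p.1 p.2))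
    (hxc : ∀ u v : ℝ, x u v ≠ c)
    (y : ℝ → ℝ → E3) (hy : ∀ u v : ℝ, y u v = inv3 c r (x u v))
    (hreg : ∀ u v : ℝ, cross (pu x u v) (pv x u v) ≠ 0)
    (heta : ∀ u v : ℝ, eta c x u v = 0) :
    ∀ u v : ℝ,
      (SFe y u v * SFg y u v - SFf y u v ^ 2) / (FFE y u v * FFG y u v - FFF y u v ^ 2) =
        (lam c r x u v ^ 2)⁻¹ *
          ((SFe x u v * SFg x u v - SFf x u v ^ 2) /
            (FFE x u v * FFG x u v - FFF x u v ^ 2)) ∧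
      Real.sign ((SFe y u v * SFg y u v - SFf y u v ^ 2) /
            (FFE y u v * FFG y u v - FFF y u v ^ 2)) =
        Real.sign ((SFe x u v * SFg x u v - SFf x u v ^ 2) /
            (FFE x u v * FFG x u v - FFF x u v ^ 2)) ∧
      |(SFe y u v * SFg y u v - SFf y u v ^ 2) / (FFE y u v * FFG y u v - FFF y u v ^ 2)| =
        (lam c r x u v ^ 2)⁻¹ *
          |(SFe x u v * SFg x u v - SFf x u v ^ 2) /
            (FFE x u v * FFG x u v - FFF x u v ^ 2)| := by
  intro u v
  have hx : SmoothPatch x := hx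
  have hl : SmoothPatch (lam c r x) := smoothPatch_lam hx hxc
  have hw : SmoothPatch (fun u v => x u v - c) := ContDiff.sub hx contDiff_const
  have hy' : y = fun u v => c + lam c r x u v • (x u v - c) := by
    funext u v
    exact hy u v
  have hyu : pu y = fun u v => lam c r x u v • pu x u v + pu (lam c r x) u v • (x u v - c) := by
    rw [hy', pu_add_smul_sub hl hx]
  have hyv : pv y = fun u v => lam c r x u v • pv x u v + pv (lam c r x) u v • (x u v - c) := by
    rw [hy', pv_add_smul_sub hl hx]
  have hw0 : x u v - c ≠ 0 := sub_ne_zero.2 (hxc u v)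
  have hlpos : 0 < lam c r x u v :=
    div_pos (pow_pos hr 2) (pow_pos (norm_pos_iff.2 hw0) 2)
  have hlu : pu (lam c r x) u v * ⟪x u v - c, x u v - c⟫ =
      -2 * lam c r x u v * ⟪x u v - c, pu x u v⟫ :=
    deriv_mul_inner_of_eq_div_norm_sq (hx.differentiableAt_left u v) (hxc u v)
  have hlv : pv (lam c r x) u v * ⟪x u v - c, x u v - c⟫ =
      -2 * lam c r x u v * ⟪x u v - c, pv x u v⟫ :=
    deriv_mul_inner_of_eq_div_norm_sq (hx.differentiableAt_right u v) (hxc u v)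
  have hUw : ⟪x u v - c, unormal x u v⟫ = 0 := by
    rw [real_inner_comm]
    exact heta u v
  have hN : ⟪cross (pu x u v) (pv x u v), x u v - c⟫ = 0 := by
    have h := heta u v
    rw [eta, unormal, real_inner_smul_left] at h
    exact (mul_eq_zero.1 h).resolve_left (inv_ne_zero (norm_ne_zero_iff.2 (hreg u v)))
  have hU : unormal y u v = -unormal x u v := by
    have hl2 : lam c r x u v ^ 2 ≠ 0 := pow_ne_zero 2 hlpos.ne'
    rw [unormal, hyu, hyv, cross_smul_add_smul hw0 hN hlu hlv, norm_neg, norm_smul,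
      Real.norm_of_nonneg (sq_nonneg _), smul_neg, smul_smul, mul_inv, mul_right_comm,
      inv_mul_cancel₀ hl2, one_mul, unormal]
  have hE : FFE y u v = lam c r x u v ^ 2 * FFE x u v := by
    rw [FFE, hyu]
    exact inner_smul_add_smul hw0 hlu hlu
  have hF : FFF y u v = lam c r x u v ^ 2 * FFF x u v := by
    rw [FFF, hyu, hyv]
    exact inner_smul_add_smul hw0 hlu hlv
  have hG : FFG y u v = lam c r x u v ^ 2 * FFG x u v := by
    rw [FFG, hyv]
    exact inner_smul_add_smul hw0 hlv hlv
  have he : SFe y u v = -(lam c r x u v * SFe x u v) := by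
    rw [SFe, hU, hyu, pu_smul_add_smul hl hl.pu hx.pu hw, pu_sub_const]
    simp only [inner_neg_right, inner_add_left, real_inner_smul_left, inner_pu_unormal, hUw, SFe]
    ring
  have hf : SFf y u v = -(lam c r x u v * SFf x u v) := by
    rw [SFf, hU, hyu, pv_smul_add_smul hl hl.pu hx.pu hw, pv_sub_const]
    simp only [inner_neg_right, inner_add_left, real_inner_smul_left, inner_pu_unormal,
      inner_pv_unormal, hUw, SFf]
    ring
  have hg : SFg y u v = -(lam c r x u v * SFg x u v) := by
    rw [SFg, hU, hyv, pv_smul_add_smul hl hl.pv hx.pv hw, pv_sub_const]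
    simp only [inner_neg_right, inner_add_left, real_inner_smul_left, inner_pv_unormal, hUw, SFg]
    ring
  have hpos : 0 < (lam c r x u v ^ 2)⁻¹ := inv_pos.2 (pow_pos hlpos 2)
  have hK : (SFe y u v * SFg y u v - SFf y u v ^ 2) / (FFE y u v * FFG y u v - FFF y u v ^ 2) =
      (lam c r x u v ^ 2)⁻¹ *
        ((SFe x u v * SFg x u v - SFf x u v ^ 2) /
          (FFE x u v * FFG x u v - FFF x u v ^ 2)) := by
    rw [hE, hF, hG, he, hf, hg]
    generalize lam c r x u v = l at hlpos
    have hl0 : l ≠ 0 := hlpos.ne'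
    rw [show -(l * SFe x u v) * -(l * SFg x u v) - (-(l * SFf x u v)) ^ 2 =
        l ^ 2 * (SFe x u v * SFg x u v - SFf x u v ^ 2) by ring,
      show l ^ 2 * FFE x u v * (l ^ 2 * FFG x u v) - (l ^ 2 * FFF x u v) ^ 2 =
        l ^ 2 * (l ^ 2 * (FFE x u v * FFG x u v - FFF x u v ^ 2)) by ring,
      mul_div_mul_left _ _ (pow_ne_zero 2 hl0), div_mul_eq_div_div_swap, div_eq_inv_mul]
  refine ⟨hK, ?_, ?_⟩
  · rw [hK, sign_mul_of_pos hpos]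
  · rw [hK, abs_mul, abs_of_pos hpos]
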